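/- arXiv:1406.3776 — 5 statements merged into one kernel-verified Lean document; each statement's English description precedes it below -/
import Mathlib

section
/- The triple (𝔄_q, [·,·]_q, α_q) is a Hom-Lie superalgebra; that is, the bracket [·,·]_q is even and super skew-symmetric, and for all homogeneous X, Y, Z ∈ 𝔄_q one has (−1)^{|X||Z|}[α_q(X),[Y,Z]_q]_q + (−1)^{|Y||X|}[α_q(Y),[Z,X]_q]_q + (−1)^{|Z||Y|}[α_q(Z),[X,Y]_q]_q = 0. -/
open Finsupp

/-- Index type for the basis of the q-deformed Heisenberg-Virasoro superalgebra:
`L m, I m` (even), `G m, T m` (odd), for `m ∈ ℤ`. -/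
inductive BIdx : Type
  | L : ℤ → BIdx
  | I : ℤ → BIdx
  | G : ℤ → BIdx
  | T : ℤ → BIdx
  deriving DecidableEq

/-- The underlying super vector space `𝔄_q`: the free `ℂ`-module on the basis `BIdx`. -/
abbrev Aq : Type := BIdx →₀ ℂ

/-- Parity of the basis elements: `L, I` even (`false`), `G, T` odd (`true`). -/
def BIdx.parity : BIdx → Bool
  | .L _ => false
  | .I _ => false
  | .G _ => true
  | .T _ => true

/-- The `q`-number `{n} = (1 - qⁿ)/(1 - q)`. -/
noncomputable def qnum (q : ℂ) (n : ℤ) : ℂ := (1 - q ^ n) / (1 - q)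

/-- The bracket `[·,·]_q` on basis elements (extended by super-skew-symmetry). -/
noncomputable def bk (q : ℂ) : BIdx → BIdx → Aq
  | .L m, .L n => single (.L (m + n)) (qnum q m - qnum q n)
  | .L m, .I n => single (.I (m + n)) (-(qnum q n))
  | .I m, .L n => single (.I (m + n)) (qnum q m)
  | .L m, .G n => single (.G (m + n)) (qnum q m - qnum q (n + 1))
  | .G m, .L n => single (.G (m + n)) (qnum q (m + 1) - qnum q n)
  | .I m, .G n => single (.T (m + n)) (qnum q m)
  | .G m, .I n => single (.T (m + n)) (-(qnum q n))
  | .L m, .T n => single (.T (m + n)) (-(qnum q (n + 1)))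
  | .T m, .L n => single (.T (m + n)) (qnum q (m + 1))
  | _, _ => 0

/-- Bilinear extension of the bracket `[·,·]_q` to all of `𝔄_q`. -/
noncomputable def bkA (q : ℂ) (x y : Aq) : Aq :=
  x.sum fun i a => y.sum fun j b => (a * b) • bk q i j

/-- The eigenvalue of the twist map `α_q` on each basis element. -/
noncomputable def acoef (q : ℂ) : BIdx → ℂ
  | .L n => 1 + q ^ n
  | .I n => 1 + q ^ n
  | .G n => 1 + q ^ (n + 1)
  | .T n => 1 + q ^ (n + 1)

/-- The even linear twist map `α_q` of `𝔄_q`. -/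
noncomputable def alq (q : ℂ) (x : Aq) : Aq :=
  x.sum fun i a => single i (acoef q i * a)

/-- `x` is homogeneous of parity `p`. -/
def homOf (p : Bool) (x : Aq) : Prop := ∀ i ∈ x.support, BIdx.parity i = p

/-- The sign `(−1)^{|x||y|}` for parities `a`, `b`. -/
noncomputable def sgn (a b : Bool) : ℂ := if a && b then -1 else 1

theorem bkA_single (q : ℂ) (i j : BIdx) (a b : ℂ) :
    bkA q (single i a) (single j b) = (a * b) • bk q i j := by
  unfold bkA
  rw [Finsupp.sum_single_index (by simp), Finsupp.sum_single_index (by simp)]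

theorem bkA_zero_left (q : ℂ) (y : Aq) : bkA q 0 y = 0 := by
  simp [bkA]

theorem bkA_zero_right (q : ℂ) (x : Aq) : bkA q x 0 = 0 := by
  simp [bkA]

theorem bkA_add_left (q : ℂ) (x x' y : Aq) : bkA q (x + x') y = bkA q x y + bkA q x' y := by
  unfold bkA
  refine Finsupp.sum_add_index' (fun i => by simp) (fun i a a' => ?_)
  rw [← Finsupp.sum_add]
  simp only [add_mul, add_smul]

theorem bkA_add_right (q : ℂ) (x y y' : Aq) : bkA q x (y + y') = bkA q x y + bkA q x y' := by
  unfold bkA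
  rw [← Finsupp.sum_add]
  congr 1
  funext i a
  exact Finsupp.sum_add_index' (fun i => by simp) (fun i a a' => by simp only [mul_add, add_smul])

theorem alq_zero (q : ℂ) : alq q 0 = 0 := by
  simp [alq]

theorem alq_add (q : ℂ) (x y : Aq) : alq q (x + y) = alq q x + alq q y := by
  unfold alq
  exact Finsupp.sum_add_index' (fun i => by simp) (fun i a a' => by simp [mul_add])

theorem alq_single (q : ℂ) (i : BIdx) (a : ℂ) :
    alq q (single i a) = single i (acoef q i * a) := by
  unfold alq
  rw [Finsupp.sum_single_index (by simp)]

/-- Induction principle for homogeneous elements. -/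
theorem homOf_ind {p : Bool} {P : Aq → Prop} (h0 : P 0)
    (hadd : ∀ x y, P x → P y → P (x + y))
    (hs : ∀ i a, BIdx.parity i = p → P (single i a)) (x : Aq) (hx : homOf p x) : P x := by
  rw [← Finsupp.sum_single x]
  exact Finset.sum_induction _ P hadd h0 (fun i hi => hs i _ (hx i hi))

theorem homOf_zero (p : Bool) : homOf p 0 := by
  intro i hi
  simp at hi

theorem homOf_add {p : Bool} {x y : Aq} (hx : homOf p x) (hy : homOf p y) :
    homOf p (x + y) := by
  intro i hi
  rcases Finset.mem_union.1 (Finsupp.support_add hi) with h | h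
  · exact hx i h
  · exact hy i h

theorem homOf_single {p : Bool} {i : BIdx} (a : ℂ) (hi : BIdx.parity i = p) :
    homOf p (single i a) := by
  intro j hj
  have := Finset.mem_singleton.1 (Finsupp.support_single_subset hj)
  rw [this, hi]

theorem homOf_smul {p : Bool} {x : Aq} (a : ℂ) (hx : homOf p x) : homOf p (a • x) :=
  fun i hi => hx i (Finsupp.support_smul hi)

theorem homOf_bk (q : ℂ) (i j : BIdx) : homOf (xor i.parity j.parity) (bk q i j) := by
  cases i <;> cases j <;> first | exact homOf_zero _ | exact homOf_single _ rfl

theorem bk_skew (q : ℂ) (i j : BIdx) :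
    bk q i j = -(sgn i.parity j.parity) • bk q j i := by
  cases i <;> cases j <;> simp [bk, sgn, BIdx.parity, add_comm, ← Finsupp.single_neg]

theorem jacobi_single (q : ℂ) (hq0 : q ≠ 0) (hq1 : q ≠ 1) (i j k : BIdx) (a b c : ℂ) :
    sgn i.parity k.parity • bkA q (alq q (single i a)) (bkA q (single j b) (single k c))
      + sgn j.parity i.parity • bkA q (alq q (single j b)) (bkA q (single k c) (single i a))
      + sgn k.parity j.parity • bkA q (alq q (single k c)) (bkA q (single i a) (single j b))
      = 0 := by
  have h1 : 1 - q ≠ 0 := sub_ne_zero.2 (Ne.symm hq1)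
  rcases i with m | m | m | m <;> rcases j with n | n | n | n <;> rcases k with r | r | r | r <;>
    simp only [bkA_single, alq_single, bk, smul_zero, bkA_zero_right, add_zero, zero_add,
      Finsupp.smul_single, sgn, BIdx.parity, acoef, Bool.and_true, Bool.and_false, if_true,
      Bool.false_eq_true, if_false, smul_eq_mul] <;>
    (rw [show n + (r + m) = m + (n + r) by ring, show r + (m + n) = m + (n + r) by ring]
     simp only [← Finsupp.single_add]
     rw [Finsupp.single_eq_zero]
     simp only [qnum, zpow_add₀ hq0, zpow_one]
     field_simp
     ring)

/-- `(𝔄_q, [·,·]_q, α_q)` is a Hom-Lie superalgebra: the bracket is even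
(maps homogeneous elements of parities `p, r` to a homogeneous element of parity `p + r`),
super skew-symmetric, and satisfies the cyclic super Hom-Jacobi identity
`(−1)^{|X||Z|}[α_q X,[Y,Z]_q]_q + (−1)^{|Y||X|}[α_q Y,[Z,X]_q]_q + (−1)^{|Z||Y|}[α_q Z,[X,Y]_q]_q = 0`
for all homogeneous `X, Y, Z`. -/
theorem q_deformed_HeisenbergVirasoro_isHomLieSuperalgebra
    (q : ℂ) (hq0 : q ≠ 0) (hq1 : q ≠ 1) :
    (∀ (px py : Bool) (x y : Aq), homOf px x → homOf py y →
        homOf (xor px py) (bkA q x y)) ∧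
    (∀ (px py : Bool) (x y : Aq), homOf px x → homOf py y →
        bkA q x y = -(sgn px py) • bkA q y x) ∧
    (∀ (px py pz : Bool) (x y z : Aq), homOf px x → homOf py y → homOf pz z →
        sgn px pz • bkA q (alq q x) (bkA q y z)
          + sgn py px • bkA q (alq q y) (bkA q z x)
          + sgn pz py • bkA q (alq q z) (bkA q x y) = 0) := by
  refine ⟨?_, ?_, ?_⟩
  · intro px py x y hx hy
    refine homOf_ind (P := fun x => homOf (xor px py) (bkA q x y)) ?_ ?_ ?_ x hx
    · simpa only [bkA_zero_left] using homOf_zero _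
    · intro x x' h h'
      simpa only [bkA_add_left] using homOf_add h h'
    intro i a hi
    refine homOf_ind (P := fun y => homOf (xor px py) (bkA q (single i a) y)) ?_ ?_ ?_ y hy
    · simpa only [bkA_zero_right] using homOf_zero _
    · intro x x' h h'
      simpa only [bkA_add_right] using homOf_add h h'
    intro j b hj
    subst hi hj
    rw [bkA_single]
    exact homOf_smul _ (homOf_bk q i j)
  · intro px py x y hx hy
    refine homOf_ind (P := fun x => bkA q x y = -(sgn px py) • bkA q y x) ?_ ?_ ?_ x hx
    · simp only [bkA_zero_left, bkA_zero_right, smul_zero]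
    · intro x x' h h'
      simp only [bkA_add_left, bkA_add_right, smul_add, h, h']
    intro i a hi
    refine homOf_ind (P := fun y => bkA q (single i a) y = -(sgn px py) • bkA q y (single i a))
      ?_ ?_ ?_ y hy
    · simp only [bkA_zero_left, bkA_zero_right, smul_zero]
    · intro x x' h h'
      simp only [bkA_add_left, bkA_add_right, smul_add, h, h']
    intro j b hj
    subst hi hj
    rw [bkA_single, bkA_single, bk_skew q i j, smul_comm, mul_comm]
  · intro px py pz x y z hx hy hz
    refine homOf_ind (P := fun x => sgn px pz • bkA q (alq q x) (bkA q y z)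
          + sgn py px • bkA q (alq q y) (bkA q z x)
          + sgn pz py • bkA q (alq q z) (bkA q x y) = 0) ?_ ?_ ?_ x hx
    · simp only [bkA_zero_left, bkA_zero_right, smul_zero, alq_zero, add_zero]
    · intro x x' h h'
      simp only [bkA_add_left, bkA_add_right, smul_add, alq_add]
      rw [← add_zero (0 : Aq)]
      nth_rewrite 1 [← h]
      rw [← h']
      abel
    intro i a hi
    refine homOf_ind (P := fun y => sgn px pz • bkA q (alq q (single i a)) (bkA q y z)
          + sgn py px • bkA q (alq q y) (bkA q z (single i a))
          + sgn pz py • bkA q (alq q z) (bkA q (single i a) y) = 0) ?_ ?_ ?_ y hy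
    · simp only [bkA_zero_left, bkA_zero_right, smul_zero, alq_zero, add_zero]
    · intro x x' h h'
      simp only [bkA_add_left, bkA_add_right, smul_add, alq_add]
      rw [← add_zero (0 : Aq)]
      nth_rewrite 1 [← h]
      rw [← h']
      abel
    intro j b hj
    refine homOf_ind (P := fun z => sgn px pz • bkA q (alq q (single i a)) (bkA q (single j b) z)
          + sgn py px • bkA q (alq q (single j b)) (bkA q z (single i a))
          + sgn pz py • bkA q (alq q z) (bkA q (single i a) (single j b)) = 0) ?_ ?_ ?_ z hz
    · simp only [bkA_zero_left, bkA_zero_right, smul_zero, alq_zero, add_zero]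
    · intro x x' h h'
      simp only [bkA_add_left, bkA_add_right, smul_add, alq_add]
      rw [← add_zero (0 : Aq)]
      nth_rewrite 1 [← h]
      rw [← h']
      abel
    intro k c hk
    subst hi hj hk
    exact jacobi_single q hq0 hq1 i j k a b c
end

section
/- Let (𝒜,[·,·],α) be a multiplicative Hom-Leibniz superalgebra and (V,β) a module over 𝒜. For every n-hom-cochain φ ∈ C^n_{α,β}(𝒜,V), the map δ^n(φ) satisfies δ^n(φ)(α(x₁),…,α(x_{n+1})) = β(δ^n(φ)(x₁,…,x_{n+1})) for all x₁,…,x_{n+1} ∈ 𝒜; in particular δ^n maps C^n_{α,β}(𝒜,V) into C^{n+1}_{α,β}(𝒜,V). -/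
/-- `pn b` is the parity `|x| ∈ {0,1}` as a natural number. -/
def pn (b : Bool) : ℕ := if b then 1 else 0

/-- A multiplicative Hom-Leibniz superalgebra over `K`: a `ℤ₂`-graded vector space `A`
with an even bilinear bracket `br` and an even linear map `α` satisfying the
super Hom-Leibniz identity, with `α` multiplicative. -/
structure HomLeibnizSuper (K A : Type*) [Field K] [AddCommGroup A] [Module K A] where
  deg : Bool → Submodule K A
  grading_sup : deg false ⊔ deg true = ⊤
  grading_inf : deg false ⊓ deg true = ⊥
  br : A →ₗ[K] A →ₗ[K] A
  α : A →ₗ[K] A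
  α_even : ∀ b : Bool, ∀ x ∈ deg b, α x ∈ deg b
  br_even : ∀ b c : Bool, ∀ x ∈ deg b, ∀ y ∈ deg c, br x y ∈ deg (xor b c)
  leibniz : ∀ b c d : Bool, ∀ x ∈ deg b, ∀ y ∈ deg c, ∀ z ∈ deg d,
    br (br x y) (α z)
      = br (α x) (br y z) - ((-1 : K) ^ (pn b * pn c)) • br (α y) (br x z)
  mult : ∀ b c : Bool, ∀ x ∈ deg b, ∀ y ∈ deg c, α (br x y) = br (α x) (α y)

/-- A module `(V, β)` over a Hom-Leibniz superalgebra `S`, with the left and right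
actions `ml : 𝒜 × V → V`, `mr : V × 𝒜 → V` and the five axioms (1.4)–(1.8). -/
structure HLSModule {K A : Type*} [Field K] [AddCommGroup A] [Module K A]
    (S : HomLeibnizSuper K A) (V : Type*) [AddCommGroup V] [Module K V] where
  deg : Bool → Submodule K V
  grading_sup : deg false ⊔ deg true = ⊤
  grading_inf : deg false ⊓ deg true = ⊥
  β : V →ₗ[K] V
  ml : A →ₗ[K] V →ₗ[K] V
  mr : V →ₗ[K] A →ₗ[K] V
  β_even : ∀ b : Bool, ∀ v ∈ deg b, β v ∈ deg b
  ml_even : ∀ b c : Bool, ∀ x ∈ S.deg b, ∀ v ∈ deg c, ml x v ∈ deg (xor b c)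
  mr_even : ∀ b c : Bool, ∀ v ∈ deg b, ∀ x ∈ S.deg c, mr v x ∈ deg (xor b c)
  ax1 : ∀ b c : Bool, ∀ v ∈ deg b, ∀ x ∈ S.deg c, β (mr v x) = mr (β v) (S.α x)
  ax2 : ∀ b c : Bool, ∀ x ∈ S.deg b, ∀ v ∈ deg c, β (ml x v) = ml (S.α x) (β v)
  ax3 : ∀ b c d : Bool, ∀ x ∈ S.deg b, ∀ y ∈ S.deg c, ∀ v ∈ deg d,
    ml (S.br x y) (β v)
      = ml (S.α x) (ml y v) - ((-1 : K) ^ (pn b * pn c)) • ml (S.α y) (ml x v)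
  ax4 : ∀ b c d : Bool, ∀ x ∈ S.deg b, ∀ v ∈ deg c, ∀ y ∈ S.deg d,
    mr (ml x v) (S.α y)
      = ml (S.α x) (mr v y) - ((-1 : K) ^ (pn b * pn c)) • mr (β v) (S.br x y)
  ax5 : ∀ b c d : Bool, ∀ v ∈ deg b, ∀ x ∈ S.deg c, ∀ y ∈ S.deg d,
    mr (mr v x) (S.α y)
      = mr (β v) (S.br x y) - ((-1 : K) ^ (pn b * pn c)) • ml (S.α x) (mr v y)

variable {K A V : Type*} [Field K] [AddCommGroup A] [Module K A]
  [AddCommGroup V] [Module K V]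

/-- The coboundary operator `δⁿ` of the cohomology of a Hom-Leibniz superalgebra with
coefficients in a module `(V, β)`.  An `n`-cochain is encoded as a family, indexed by the
parity vector `p : Fin n → Bool` of its (homogeneous) arguments, of `n`-linear maps
`(Fin n → A) → V`; `pφ` is the parity of the cochain. -/
noncomputable def coboundary (S : HomLeibnizSuper K A) (M : HLSModule S V)
    (n : ℕ) (pφ : Bool) (φ : (Fin n → Bool) → (Fin n → A) → V)
    (p : Fin (n + 1) → Bool) (x : Fin (n + 1) → A) : V :=
  M.ml ((⇑S.α)^[n - 1] (x 0)) (φ (fun k => p k.succ) (fun k => x k.succ))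
  + ∑ i : Fin (n + 1),
      (if i = 0 then 0 else
        ((-1 : K) ^ ((i : ℕ) + 1 + pn (p i) * (pn pφ + ∑ k ∈ Finset.Ioi i, pn (p k)))) •
          M.mr (φ (fun k => p (i.succAbove k)) (fun k => x (i.succAbove k)))
            ((⇑S.α)^[n - 1] (x i)))
  + ∑ j : Fin (n + 1), ∑ i ∈ Finset.Iio j,
      ((-1 : K) ^ ((j : ℕ) + pn (p j) * ∑ k ∈ Finset.Ioo i j, pn (p k))) •
        φ (fun k => if j.succAbove k = i then xor (p i) (p j) else p (j.succAbove k))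
          (fun k => if j.succAbove k = i then S.br (x i) (x j)
                    else S.α (x (j.succAbove k)))

/-- Lemma 2.3: over a field of characteristic zero, for a multiplicative
Hom-Leibniz superalgebra `S` and a module `(V, β)`, and any `n`-hom-cochain `φ`
(compatible: `β ∘ φ = φ ∘ α^{⊗n}`, multilinear, homogeneous of parity `pφ`),
the coboundary satisfies `δⁿφ ∘ α^{⊗(n+1)} = β ∘ δⁿφ` on homogeneous arguments;
in particular `δⁿ` maps `C^n_{α,β}(𝒜,V)` into `C^{n+1}_{α,β}(𝒜,V)`. -/
theorem coboundary_compat [CharZero K]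
    (S : HomLeibnizSuper K A) (M : HLSModule S V)
    (n : ℕ) (hn : 1 ≤ n) (pφ : Bool)
    (φ : (Fin n → Bool) → (Fin n → A) → V)
    (hφcompat : ∀ (p : Fin n → Bool) (x : Fin n → A),
      M.β (φ p x) = φ p (fun k => S.α (x k)))
    (hφadd : ∀ (p : Fin n → Bool) (x : Fin n → A) (i : Fin n) (a b : A),
      φ p (Function.update x i (a + b))
        = φ p (Function.update x i a) + φ p (Function.update x i b))
    (hφsmul : ∀ (p : Fin n → Bool) (x : Fin n → A) (i : Fin n) (c : K) (a : A),
      φ p (Function.update x i (c • a)) = c • φ p (Function.update x i a))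
    (hφhom : ∀ (p : Fin n → Bool) (x : Fin n → A), (∀ k, x k ∈ S.deg (p k)) →
      φ p x ∈ M.deg (xor pφ (decide ((∑ k, pn (p k)) % 2 = 1)))) :
    ∀ (p : Fin (n + 1) → Bool) (x : Fin (n + 1) → A), (∀ k, x k ∈ S.deg (p k)) →
      coboundary S M n pφ φ p (fun k => S.α (x k))
        = M.β (coboundary S M n pφ φ p x) := by
  intro p x hx
  have hiter : ∀ (m : ℕ) (b : Bool) (a : A), a ∈ S.deg b → (⇑S.α)^[m] a ∈ S.deg b := by
    intro m
    induction m with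
    | zero => intro b a h; exact h
    | succ m ih =>
      intro b a h
      rw [Function.iterate_succ_apply']
      exact S.α_even b _ (ih b a h)
  have hcomm : ∀ (m : ℕ) (a : A), (⇑S.α)^[m] (S.α a) = S.α ((⇑S.α)^[m] a) := by
    intro m a
    rw [← Function.iterate_succ_apply, Function.iterate_succ_apply']
  unfold coboundary
  simp only [map_add, map_sum]
  congr 1
  · congr 1
    · rw [M.ax2 (p 0) _ _ (hiter _ _ _ (hx 0)) _ (hφhom _ _ (fun k => hx k.succ)),
        hφcompat, hcomm]
    · refine Finset.sum_congr rfl fun i _ => ?_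
      split_ifs with h
      · simp
      · rw [map_smul, M.ax1 _ (p i) _ (hφhom _ _ (fun k => hx (i.succAbove k))) _
          (hiter _ _ _ (hx i)), hφcompat, hcomm]
  · refine Finset.sum_congr rfl fun j _ => Finset.sum_congr rfl fun i _ => ?_
    rw [map_smul, hφcompat]
    congr 2
    funext k
    split_ifs with h
    · exact (S.mult _ _ _ (hx i) _ (hx j)).symm
    · rfl
end

section
/- Assume additionally that q^n ≠ −1 for every n ∈ ℤ. The bilinear map ψ: 𝔄_q × 𝔄_q → ℂ defined on basis elements by ψ(I_n, I_m) = δ_{n+m,0}·2q^m{n}/(1+q^m) and ψ = 0 on all other pairs of basis elements satisfies the 2-cocycle identity −ψ([x₀,x₁]_q, α_q(x₂)) + (−1)^{|x₁||x₂|} ψ([x₀,x₂]_q, α_q(x₁)) + ψ(α_q(x₀), [x₁,x₂]_q) = 0 for all homogeneous x₀, x₁, x₂ ∈ 𝔄_q. -/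
open Finsupp

/-- Evaluation of the bilinear form with basis coefficients `c` on elements of `𝔄_q`. -/
noncomputable def cA (c : BIdx → BIdx → ℂ) (x y : Aq) : ℂ :=
  x.sum fun i a => y.sum fun j b => a * b * c i j

/-- `c` is even: it vanishes on pairs of basis elements of opposite parity. -/
def IsEvenBilinear (c : BIdx → BIdx → ℂ) : Prop :=
  ∀ i j : BIdx, BIdx.parity i ≠ BIdx.parity j → c i j = 0

/-- The 2-cocycle identity (with trivial coefficients) for the bilinear form `c`,
stated for all homogeneous `x₀, x₁, x₂ ∈ 𝔄_q`. -/
def Cocycle2Identity (q : ℂ) (c : BIdx → BIdx → ℂ) : Prop :=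
  ∀ (p0 p1 p2 : Bool) (x0 x1 x2 : Aq), homOf p0 x0 → homOf p1 x1 → homOf p2 x2 →
    -(cA c (bkA q x0 x1) (alq q x2)) + sgn p1 p2 * cA c (bkA q x0 x2) (alq q x1)
      + cA c (alq q x0) (bkA q x1 x2) = 0

/-- An even bilinear 2-cocycle of `𝔄_q` with trivial coefficients. -/
def IsCocycle (q : ℂ) (c : BIdx → BIdx → ℂ) : Prop :=
  IsEvenBilinear c ∧ Cocycle2Identity q c

/-- Evaluation of the linear form with basis coefficients `f` on an element of `𝔄_q`. -/
noncomputable def fA (f : BIdx → ℂ) (x : Aq) : ℂ := x.sum fun i a => a * f i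

/-- `c` is a 2-coboundary: `c(x,y) = −f([x,y]_q)` for some even linear map `f : 𝔄_q → ℂ`. -/
def IsCoboundary (q : ℂ) (c : BIdx → BIdx → ℂ) : Prop :=
  ∃ f : BIdx → ℂ, (∀ i : BIdx, BIdx.parity i = true → f i = 0) ∧
    ∀ i j : BIdx, c i j = -(fA f (bk q i j))

/-- The 2-cocycle `ϕ`, supported on pairs `(L_n, L_{-n})`. -/
noncomputable def phi1 (q : ℂ) : BIdx → BIdx → ℂ
  | .L n, .L m =>
      if n + m = 0 then
        q ^ (-n) * qnum q (n + 1) * qnum q n * qnum q (n - 1) / (6 * (1 + q ^ n))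
      else 0
  | _, _ => 0

/-- Auxiliary value `φ(L_n, I_m)`. -/
noncomputable def phiLI (q : ℂ) (n m : ℤ) : ℂ :=
  if n + m = 0 then 2 * q ^ (-n) * qnum q (n + 1) * qnum q n / (1 + q ^ n) else 0

/-- The 2-cocycle `φ`, supported on pairs `(L_n, I_m)` and `(I_m, L_n)`. -/
noncomputable def phi2 (q : ℂ) : BIdx → BIdx → ℂ
  | .L n, .I m => phiLI q n m
  | .I m, .L n => -phiLI q n m
  | _, _ => 0

/-- The 2-cocycle `ψ`, supported on pairs `(I_n, I_{-n})`. -/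
noncomputable def phi3 (q : ℂ) : BIdx → BIdx → ℂ
  | .I n, .I m => if n + m = 0 then 2 * q ^ m * qnum q n / (1 + q ^ m) else 0
  | _, _ => 0

theorem cA_sum_left {ι : Type*} (c : BIdx → BIdx → ℂ) (s : Finset ι) (f : ι → Aq) (y : Aq) :
    cA c (∑ i ∈ s, f i) y = ∑ i ∈ s, cA c (f i) y := by
  unfold cA
  exact (Finsupp.sum_finsetSum_index (s := s) (g := f)
    (h := fun i a => y.sum fun j b => a * b * c i j) (by intro a; simp)
    (by intro a b₁ b₂; simp only [add_mul, Finsupp.sum_add])).symm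

theorem cA_sum_right {ι : Type*} (c : BIdx → BIdx → ℂ) (s : Finset ι) (f : ι → Aq) (x : Aq) :
    cA c x (∑ i ∈ s, f i) = ∑ i ∈ s, cA c x (f i) := by
  unfold cA
  simp only [Finsupp.sum]
  refine Eq.trans ?_ Finset.sum_comm
  refine Finset.sum_congr rfl fun i _ => ?_
  exact (Finsupp.sum_finsetSum_index (s := s) (g := f)
    (h := fun j b => x i * b * c i j) (by intro a; simp) (by intro a b₁ b₂; ring)).symm

theorem cA_smul_left (c : BIdx → BIdx → ℂ) (r : ℂ) (x y : Aq) :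
    cA c (r • x) y = r * cA c x y := by
  unfold cA
  rw [Finsupp.sum_smul_index (by intro i; simp)]
  simp only [Finsupp.sum, Finset.mul_sum, mul_assoc]

theorem cA_smul_right (c : BIdx → BIdx → ℂ) (r : ℂ) (x y : Aq) :
    cA c x (r • y) = r * cA c x y := by
  unfold cA
  rw [Finsupp.sum, Finsupp.sum, Finset.mul_sum]
  refine Finset.sum_congr rfl fun i _ => ?_
  rw [Finsupp.sum_smul_index (by intro i; simp), Finsupp.sum, Finsupp.sum, Finset.mul_sum]
  refine Finset.sum_congr rfl fun j _ => ?_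
  ring

theorem cA_single (c : BIdx → BIdx → ℂ) (i j : BIdx) (a b : ℂ) :
    cA c (single i a) (single j b) = a * b * c i j := by
  simp [cA]

theorem cA_zero_left (c : BIdx → BIdx → ℂ) (y : Aq) : cA c 0 y = 0 := by
  simp [cA]

theorem cA_zero_right (c : BIdx → BIdx → ℂ) (y : Aq) : cA c y 0 = 0 := by
  simp [cA]

theorem bkA_eq (q : ℂ) (x y : Aq) :
    bkA q x y = ∑ i ∈ x.support, ∑ j ∈ y.support, (x i * y j) • bk q i j := rfl

theorem alq_eq (q : ℂ) (x : Aq) :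
    alq q x = ∑ i ∈ x.support, x i • single i (acoef q i) := by
  unfold alq Finsupp.sum
  refine Finset.sum_congr rfl fun i _ => ?_
  rw [Finsupp.smul_single, smul_eq_mul, mul_comm]

theorem term_left (q : ℂ) (c : BIdx → BIdx → ℂ) (x y z : Aq) :
    cA c (bkA q x y) (alq q z) = ∑ i ∈ x.support, ∑ j ∈ y.support, ∑ k ∈ z.support,
      x i * y j * z k * cA c (bk q i j) (single k (acoef q k)) := by
  rw [bkA_eq, alq_eq]
  simp only [cA_sum_left, cA_smul_left]
  simp only [cA_sum_right, cA_smul_right, Finset.mul_sum, mul_assoc]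

theorem term_right (q : ℂ) (c : BIdx → BIdx → ℂ) (x y z : Aq) :
    cA c (alq q x) (bkA q y z) = ∑ i ∈ x.support, ∑ j ∈ y.support, ∑ k ∈ z.support,
      x i * y j * z k * cA c (single i (acoef q i)) (bk q j k) := by
  rw [bkA_eq, alq_eq]
  simp only [cA_sum_left, cA_smul_left]
  simp only [cA_sum_right, cA_smul_right, Finset.mul_sum, mul_assoc]

theorem cocycle_of_basis (q : ℂ) (c : BIdx → BIdx → ℂ)
    (h : ∀ i j k : BIdx, -(cA c (bk q i j) (single k (acoef q k)))
      + sgn j.parity k.parity * cA c (bk q i k) (single j (acoef q j))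
      + cA c (single i (acoef q i)) (bk q j k) = 0) : Cocycle2Identity q c := by
  intro p0 p1 p2 x0 x1 x2 _ h1 h2
  rw [term_left, term_left, term_right]
  have e : ∀ i ∈ x0.support, (∑ k ∈ x2.support, ∑ j ∈ x1.support,
      x0 i * x2 k * x1 j * cA c (bk q i k) (single j (acoef q j))) =
      ∑ j ∈ x1.support, ∑ k ∈ x2.support,
      x0 i * x2 k * x1 j * cA c (bk q i k) (single j (acoef q j)) :=
    fun i _ => Finset.sum_comm
  rw [Finset.sum_congr rfl e]
  simp only [Finset.mul_sum, ← Finset.sum_neg_distrib, ← Finset.sum_add_distrib]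
  refine Finset.sum_eq_zero fun i _ => Finset.sum_eq_zero fun j hj =>
    Finset.sum_eq_zero fun k hk => ?_
  have := h i j k
  rw [h1 j hj, h2 k hk] at this
  linear_combination (x0 i * x1 j * x2 k) * this

/-- The value `2 q^m {n} / (1 + q^m)` at `n = -m`, cleared of its denominator. -/
theorem phi3_val (q : ℂ) (hq0 : q ≠ 0) (hq : ∀ n : ℤ, q ^ n ≠ -1) (n m : ℤ) :
    (1 + q ^ m) * phi3 q (.I n) (.I m) = if n + m = 0 then -2 * qnum q m else 0 := by
  have h : (1 : ℂ) + q ^ m ≠ 0 := fun h => hq m (by linear_combination h)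
  have hm : q ^ m ≠ 0 := zpow_ne_zero _ hq0
  simp only [phi3]
  split_ifs with hnm
  · obtain rfl : n = -m := by omega
    simp only [qnum, zpow_neg]
    field_simp
    ring
  · simp

theorem phi3_val' (q : ℂ) (hq0 : q ≠ 0) (hq : ∀ n : ℤ, q ^ n ≠ -1) (n m : ℤ) :
    (1 + q ^ n) * phi3 q (.I n) (.I m) = if n + m = 0 then 2 * qnum q n else 0 := by
  have h : (1 : ℂ) + q ^ n ≠ 0 := fun h => hq n (by linear_combination h)
  have hm : q ^ n ≠ 0 := zpow_ne_zero _ hq0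
  simp only [phi3]
  split_ifs with hnm
  · obtain rfl : m = -n := by omega
    have h' : (1 : ℂ) + (q ^ n)⁻¹ ≠ 0 := by
      rw [← zpow_neg]; exact fun h => hq (-n) (by linear_combination h)
    have h2 : q ^ n + 1 ≠ 0 := by rwa [add_comm]
    simp only [zpow_neg]
    have e : (1 : ℂ) + (q ^ n)⁻¹ = (1 + q ^ n) * (q ^ n)⁻¹ := by field_simp; ring
    rw [e]
    field_simp
  · simp

theorem basis_id (q : ℂ) (hq0 : q ≠ 0) (hq : ∀ n : ℤ, q ^ n ≠ -1) (i j k : BIdx) :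
    -(cA (phi3 q) (bk q i j) (single k (acoef q k)))
      + sgn j.parity k.parity * cA (phi3 q) (bk q i k) (single j (acoef q j))
      + cA (phi3 q) (single i (acoef q i)) (bk q j k) = 0 := by
  have v := phi3_val q hq0 hq
  have v' := phi3_val' q hq0 hq
  rcases i with a | a | a | a <;> rcases j with b | b | b | b <;> rcases k with d | d | d | d <;>
    simp only [bk, cA_zero_left, cA_zero_right, cA_single, acoef, BIdx.parity, sgn]
  case L.I.I =>
    have h1 := v (a + b) d
    have h2 := v (a + d) b
    rw [show a + d + b = a + b + d by ring] at h2
    simp only [Bool.and_self, Bool.false_eq_true, if_false]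
    split_ifs at h1 h2 <;> linear_combination (qnum q b) * h1 - (qnum q d) * h2
  case I.L.I =>
    have h1 := v (a + b) d
    have h2 := v' a (b + d)
    rw [← add_assoc] at h2
    simp only [phi3, mul_zero, add_zero]
    simp only [phi3] at h1 h2
    split_ifs at * <;> linear_combination -(qnum q a) * h1 - (qnum q d) * h2
  case I.I.L =>
    have h1 := v (a + d) b
    have h2 := v' a (b + d)
    rw [show a + d + b = a + (b + d) by ring] at h1
    simp only [Bool.and_self, Bool.false_eq_true, if_false]
    split_ifs at h1 h2 <;> linear_combination (qnum q a) * h1 + (qnum q b) * h2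
  all_goals simp [phi3]

/-- assuming `qⁿ ≠ −1` for all `n ∈ ℤ`, the bilinear map `ψ = phi3`
satisfies the 2-cocycle identity for all homogeneous `x₀, x₁, x₂ ∈ 𝔄_q`. -/
theorem phi3_is_two_cocycle (q : ℂ) (hq0 : q ≠ 0) (hq1 : q ≠ 1)
    (hq : ∀ n : ℤ, q ^ n ≠ -1) :
    Cocycle2Identity q (phi3 q) := by
  exact cocycle_of_basis q _ (basis_id q hq0 hq)
end

section
/- Let s ∈ ℤ with s ≠ 0 and assume q^s ≠ 1 and q^s ≠ −1. Then every even q-derivation φ of 𝔄_q homogeneous of degree s is inner: φ is a linear combination of ad_{L_s} and ad_{I_s}, i.e. the space of even q-derivations of degree s equals the span of ad_{L_s} and ad_{I_s}. -/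
open Finsupp

/-- The span of the basis elements `L_n, I_n`. -/
noncomputable def spanLI (n : ℤ) : Submodule ℂ Aq :=
  Submodule.span ℂ {single (BIdx.L n) (1 : ℂ), single (BIdx.I n) (1 : ℂ)}

/-- The span of the basis elements `G_n, T_n`. -/
noncomputable def spanGT (n : ℤ) : Submodule ℂ Aq :=
  Submodule.span ℂ {single (BIdx.G n) (1 : ℂ), single (BIdx.T n) (1 : ℂ)}

/-- The linear extension of a map `D` given by its values on the basis. -/
noncomputable def DA (D : BIdx → Aq) (x : Aq) : Aq := x.sum fun i a => a • D i

/-- The sign `(−1)^{|x|}` for a parity `b`. -/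
noncomputable def sgn1 (b : Bool) : ℂ := if b then -1 else 1

/-- An even `q`-derivation of `𝔄_q` homogeneous of degree `s`:
an even linear map of degree `s` with
`φ([x,y]_q) = (1+q^s)⁻¹ ([φ x, α_q y]_q + [α_q x, φ y]_q)` for homogeneous `x, y`. -/
def IsEvenQDerivation (q : ℂ) (s : ℤ) (φ : BIdx → Aq) : Prop :=
  (∀ n : ℤ, φ (.L n) ∈ spanLI (n + s) ∧ φ (.I n) ∈ spanLI (n + s) ∧
      φ (.G n) ∈ spanGT (n + s) ∧ φ (.T n) ∈ spanGT (n + s)) ∧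
  ∀ (px py : Bool) (x y : Aq), homOf px x → homOf py y →
    DA φ (bkA q x y) =
      (1 + q ^ s)⁻¹ • (bkA q (DA φ x) (alq q y) + bkA q (alq q x) (DA φ y))

/-- An odd `q`-derivation of `𝔄_q` homogeneous of degree `s`:
an odd linear map of degree `s` with
`φ([x,y]_q) = (1+q^{s+1})⁻¹ ([φ x, α_q y]_q + (−1)^{|x|}[α_q x, φ y]_q)`
for homogeneous `x, y`. -/
def IsOddQDerivation (q : ℂ) (s : ℤ) (φ : BIdx → Aq) : Prop :=
  (∀ n : ℤ, φ (.L n) ∈ spanGT (n + s) ∧ φ (.I n) ∈ spanGT (n + s) ∧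
      φ (.G n) ∈ spanLI (n + s) ∧ φ (.T n) ∈ spanLI (n + s)) ∧
  ∀ (px py : Bool) (x y : Aq), homOf px x → homOf py y →
    DA φ (bkA q x y) =
      (1 + q ^ (s + 1))⁻¹ •
        (bkA q (DA φ x) (alq q y) + sgn1 px • bkA q (alq q x) (DA φ y))


/-- The bracket as a bilinear map. -/
noncomputable def bkL (q : ℂ) : Aq →ₗ[ℂ] Aq →ₗ[ℂ] Aq :=
  Finsupp.linearCombination ℂ (fun i => Finsupp.linearCombination ℂ (bk q i))

/-- The twist as a linear map. -/
noncomputable def alL (q : ℂ) : Aq →ₗ[ℂ] Aq :=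
  Finsupp.linearCombination ℂ (fun i => single i (acoef q i))

theorem bkA_eq_s10 (q : ℂ) (x y : Aq) : bkA q x y = bkL q x y := by
  unfold bkA bkL
  rw [Finsupp.linearCombination_apply, Finsupp.sum, Finsupp.sum, LinearMap.sum_apply]
  refine Finset.sum_congr rfl fun i _ => ?_
  rw [LinearMap.smul_apply, Finsupp.linearCombination_apply, Finsupp.smul_sum]
  simp only [mul_smul]

theorem alq_eq_s10 (q : ℂ) (x : Aq) : alq q x = alL q x := by
  unfold alq alL
  rw [Finsupp.linearCombination_apply]
  simp [mul_comm]

theorem DA_eq (D : BIdx → Aq) (x : Aq) : DA D x = Finsupp.linearCombination ℂ D x := rfl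

theorem bkL_single (q : ℂ) (i j : BIdx) (a b : ℂ) :
    bkL q (single i a) (single j b) = a • b • bk q i j := by
  simp [bkL]

/-- The derivation identity on basis elements. -/
def DerB (q : ℂ) (s : ℤ) (φ : BIdx → Aq) : Prop :=
  ∀ i j : BIdx, Finsupp.linearCombination ℂ φ (bk q i j) =
    (1 + q ^ s)⁻¹ • (acoef q j • bkL q (φ i) (single j 1) + acoef q i • bkL q (single i 1) (φ j))

/-- The degree condition. -/
def DegC (s : ℤ) (φ : BIdx → Aq) : Prop :=
  ∀ n : ℤ, φ (.L n) ∈ spanLI (n + s) ∧ φ (.I n) ∈ spanLI (n + s) ∧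
      φ (.G n) ∈ spanGT (n + s) ∧ φ (.T n) ∈ spanGT (n + s)

theorem isEven_iff (q : ℂ) (s : ℤ) (φ : BIdx → Aq) :
    IsEvenQDerivation q s φ ↔ DegC s φ ∧ DerB q s φ := by
  have hs : ∀ i : BIdx, single i (acoef q i) = acoef q i • (single i (1 : ℂ) : Aq) := by
    intro i; simp
  constructor
  · rintro ⟨h1, h2⟩
    refine ⟨h1, fun i j => ?_⟩
    have h := h2 i.parity j.parity (single i 1) (single j 1)
      (by intro k hk; have := Finsupp.support_single_subset hk; simp at this; rw [this])
      (by intro k hk; have := Finsupp.support_single_subset hk; simp at this; rw [this])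
    simp only [bkA_eq_s10, alq_eq_s10, DA_eq, bkL_single] at h
    simp only [alL, Finsupp.linearCombination_single, one_smul] at h
    rw [hs i, hs j] at h
    simpa only [map_smul, LinearMap.smul_apply] using h
  · rintro ⟨h1, h2⟩
    refine ⟨h1, fun _ _ x y hx hy => ?_⟩
    clear hx hy
    simp only [bkA_eq_s10, alq_eq_s10, DA_eq]
    induction x using Finsupp.induction_linear with
    | zero => simp
    | add x x' hx hx' =>
      simp only [map_add, LinearMap.add_apply, hx, hx', smul_add]; abel
    | single i a =>
      induction y using Finsupp.induction_linear with
      | zero => simp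
      | add y y' hy hy' =>
        simp only [map_add, hy, hy', smul_add]; abel
      | single j b =>
        have hi : (single i a : Aq) = a • single i 1 := by simp
        have hj : (single j b : Aq) = b • single j 1 := by simp
        have h := h2 i j
        rw [hi, hj]
        simp only [map_smul, LinearMap.smul_apply, bkL_single, one_smul, h]
        simp only [alL, Finsupp.linearCombination_single, one_smul]
        rw [hs i, hs j]
        simp only [map_smul, LinearMap.smul_apply]
        module

theorem inner_deg (q : ℂ) (s : ℤ) (a b : ℂ) :
    DegC s (fun i => a • bk q (.L s) i + b • bk q (.I s) i) := by
  intro n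
  refine ⟨?_, ?_, ?_, ?_⟩
  · refine Submodule.mem_span_pair.2 ⟨a * (qnum q s - qnum q n), b * qnum q s, ?_⟩
    simp [bk, add_comm n s, -Finsupp.single_sub, -Finsupp.single_mul]
  · refine Submodule.mem_span_pair.2 ⟨0, a * (- qnum q n), ?_⟩
    simp [bk, add_comm n s, -Finsupp.single_sub, -Finsupp.single_mul]
  · refine Submodule.mem_span_pair.2 ⟨a * (qnum q s - qnum q (n+1)), b * qnum q s, ?_⟩
    simp [bk, add_comm n s, -Finsupp.single_sub, -Finsupp.single_mul]
  · refine Submodule.mem_span_pair.2 ⟨0, a * (- qnum q (n + 1)), ?_⟩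
    simp [bk, add_comm n s, -Finsupp.single_sub, -Finsupp.single_mul]

/-- Basis vector. -/
noncomputable def ev (k : BIdx) : Aq := single k 1

theorem single_eq_ev (k : BIdx) (c : ℂ) : (single k c : Aq) = c • ev k := by
  simp [ev]

theorem inner_der (q : ℂ) (hq0 : q ≠ 0) (hq1 : q ≠ 1) (s : ℤ) (hqs2 : q ^ s ≠ -1) (a b : ℂ) :
    DerB q s (fun i => a • bk q (.L s) i + b • bk q (.I s) i) := by
  have h1 : (1 - q) ≠ 0 := sub_ne_zero.2 (Ne.symm hq1)
  have h2 : 1 + q ^ s ≠ 0 := by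
    intro h; apply hqs2; linear_combination h
  intro i j
  rw [eq_inv_smul_iff₀ h2]
  rcases i with m | m | m | m <;> rcases j with n | n | n | n <;>
    (simp only [bk, map_add, map_smul, map_zero, LinearMap.add_apply, LinearMap.smul_apply,
      Finsupp.linearCombination_single, bkL_single, smul_zero, LinearMap.zero_apply, add_zero,
      zero_add, Finsupp.smul_single, smul_eq_mul, acoef, smul_add]
     try simp only [single_eq_ev,
       show s + m + n = s + (m + n) by ring, show m + (s + n) = s + (m + n) by ring]
     try
      (match_scalars <;>
       simp only [qnum, zpow_add₀ hq0, zpow_one] <;> field_simp <;> ring))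

theorem bkL0_LI (q : ℂ) (k : ℤ) (x : Aq) (hx : x ∈ spanLI k) :
    bkL q (single (.L 0) 1) x = (-qnum q k) • x := by
  obtain ⟨a, b, rfl⟩ := Submodule.mem_span_pair.1 hx
  have h0 : qnum q 0 = 0 := by simp [qnum]
  simp only [map_add, map_smul, bkL_single, one_smul, bk, h0, zero_sub, zero_add]
  simp only [Finsupp.smul_single, smul_add, smul_eq_mul, mul_one, mul_comm]

theorem bkL0_GT (q : ℂ) (k : ℤ) (x : Aq) (hx : x ∈ spanGT k) :
    bkL q (single (.L 0) 1) x = (-qnum q (k + 1)) • x := by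
  obtain ⟨a, b, rfl⟩ := Submodule.mem_span_pair.1 hx
  have h0 : qnum q 0 = 0 := by simp [qnum]
  simp only [map_add, map_smul, bkL_single, one_smul, bk, h0, zero_sub, zero_add]
  simp only [Finsupp.smul_single, smul_add, smul_eq_mul, mul_one, mul_comm]

theorem qnum_inj (q : ℂ) (hq1 : q ≠ 1) {m n : ℤ} (h : q ^ m ≠ q ^ n) :
    qnum q m - qnum q n ≠ 0 := by
  have h1 : (1 - q) ≠ 0 := sub_ne_zero.2 (Ne.symm hq1)
  intro h'
  apply h
  unfold qnum at h'
  field_simp at h'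
  linear_combination -h'

theorem qnum_ne (q : ℂ) (hq1 : q ≠ 1) {m : ℤ} (h : q ^ m ≠ 1) : qnum q m ≠ 0 := by
  have := qnum_inj q hq1 (m := m) (n := 0) (by simpa using h)
  simpa [qnum] using this

theorem kill_LI (q : ℂ) (hq1 : q ≠ 1) (k s : ℤ) (x : Aq) (hx : x ∈ spanLI k)
    (h1 : q ^ k ≠ 1) (h2 : q ^ k ≠ q ^ s) (h : bkL q x (single (.L s) 1) = 0) : x = 0 := by
  obtain ⟨a, b, rfl⟩ := Submodule.mem_span_pair.1 hx
  simp only [map_add, map_smul, LinearMap.add_apply, LinearMap.smul_apply, bkL_single, one_smul,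
    bk, Finsupp.smul_single, smul_eq_mul] at h
  have ha := DFunLike.congr_fun h (.L (k + s))
  have hb := DFunLike.congr_fun h (.I (k + s))
  simp [Finsupp.single_apply, qnum_inj q hq1 h2, qnum_ne q hq1 h1,
    -Finsupp.single_sub, -Finsupp.single_mul] at ha hb
  simp [ha, hb]

theorem kill_GT (q : ℂ) (hq1 : q ≠ 1) (k s : ℤ) (x : Aq) (hx : x ∈ spanGT k)
    (h1 : q ^ (k + 1) ≠ 1) (h2 : q ^ (k + 1) ≠ q ^ s)
    (h : bkL q x (single (.L s) 1) = 0) : x = 0 := by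
  obtain ⟨a, b, rfl⟩ := Submodule.mem_span_pair.1 hx
  simp only [map_add, map_smul, LinearMap.add_apply, LinearMap.smul_apply, bkL_single, one_smul,
    bk, Finsupp.smul_single, smul_eq_mul] at h
  have ha := DFunLike.congr_fun h (.G (k + s))
  have hb := DFunLike.congr_fun h (.T (k + s))
  simp [Finsupp.single_apply, qnum_inj q hq1 h2, qnum_ne q hq1 h1,
    -Finsupp.single_sub, -Finsupp.single_mul] at ha hb
  simp [ha, hb]

theorem scal (q : ℂ) (hq0 : q ≠ 0) (hq1 : q ≠ 1) (s w : ℤ) (hqs1 : q ^ s ≠ 1)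
    (hqs2 : q ^ s ≠ -1) (hw : 1 + q ^ w ≠ 0) (x : Aq)
    (h : (qnum q 0 - qnum q w) • x =
      (1 + q ^ s)⁻¹ • (1 + q ^ (0 : ℤ)) • (-qnum q (w + s)) • x) : x = 0 := by
  have h1 : (1 - q) ≠ 0 := sub_ne_zero.2 (Ne.symm hq1)
  have h2 : 1 + q ^ s ≠ 0 := by
    intro h; apply hqs2; linear_combination h
  have h3 : 1 - q ^ s ≠ 0 := sub_ne_zero.2 (Ne.symm hqs1)
  have h4 : ((1 + q ^ w) * (1 - q ^ s) * (1 + q ^ s)⁻¹ * (1 - q)⁻¹) • x = 0 := by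
    rw [← sub_eq_zero, smul_smul, smul_smul, ← sub_smul] at h
    rw [← h]
    congr 1
    simp only [qnum, zpow_add₀ hq0, zpow_zero]
    field_simp
    ring
  refine (smul_eq_zero.1 h4).resolve_left ?_
  positivity

theorem vanish (q : ℂ) (hq0 : q ≠ 0) (hq1 : q ≠ 1) (s : ℤ) (hqs1 : q ^ s ≠ 1)
    (hqs2 : q ^ s ≠ -1) (ψ : BIdx → Aq) (hd : DegC s ψ) (hψ : DerB q s ψ)
    (h0 : ψ (.L 0) = 0) (i : BIdx) : ψ i = 0 := by
  have hS : 1 + q ^ s ≠ 0 := by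
    intro h; apply hqs2; linear_combination h
  have key : ∀ i, acoef q i ≠ 0 → ψ i = 0 := by
    intro i hi
    have h := hψ (.L 0) i
    rw [h0] at h
    rcases i with n | n | n | n
    · rw [bkL0_LI q _ _ (hd n).1] at h
      simp only [bk, acoef, Finsupp.linearCombination_single, zero_add, map_zero, smul_zero,
        LinearMap.zero_apply] at h hi
      exact scal q hq0 hq1 s n hqs1 hqs2 hi _ h
    · rw [bkL0_LI q _ _ (hd n).2.1] at h
      simp only [bk, acoef, Finsupp.linearCombination_single, zero_add, map_zero, smul_zero,
        LinearMap.zero_apply] at h hi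
      exact scal q hq0 hq1 s n hqs1 hqs2 hi _ (by simpa [qnum] using h)
    · rw [bkL0_GT q _ _ (hd n).2.2.1] at h
      simp only [bk, acoef, Finsupp.linearCombination_single, zero_add, map_zero, smul_zero,
        LinearMap.zero_apply] at h hi
      rw [show n + s + 1 = n + 1 + s by ring] at h
      exact scal q hq0 hq1 s (n + 1) hqs1 hqs2 hi _ h
    · rw [bkL0_GT q _ _ (hd n).2.2.2] at h
      simp only [bk, acoef, Finsupp.linearCombination_single, zero_add, map_zero, smul_zero,
        LinearMap.zero_apply] at h hi
      rw [show n + s + 1 = n + 1 + s by ring] at h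
      exact scal q hq0 hq1 s (n + 1) hqs1 hqs2 hi _ (by simpa [qnum] using h)
  by_cases hi : acoef q i = 0
  swap
  · exact key i hi
  have hw : ∀ w : ℤ, 1 + q ^ w = 0 →
      1 + q ^ (w + s) ≠ 0 ∧ q ^ (w + s) ≠ 1 ∧ q ^ (w + s) ≠ q ^ s := by
    intro w hw
    have e : q ^ w = -1 := by linear_combination hw
    rw [zpow_add₀ hq0, e]
    refine ⟨fun h => hqs1 (by linear_combination -h), fun h => hqs2 (by linear_combination -h),
      fun h => zpow_ne_zero s hq0 (by linear_combination (-1 / 2 : ℂ) * h)⟩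
  have hs0 : ψ (.L s) = 0 := key _ hS
  have h := hψ i (.L s)
  rw [hi, zero_smul, add_zero] at h
  have fin : Finsupp.linearCombination ℂ ψ (bk q i (.L s)) = 0 →
      bkL q (ψ i) (single (.L s) 1) = 0 := by
    intro h'
    rw [h', eq_comm, smul_eq_zero, smul_eq_zero] at h
    exact (h.resolve_left (inv_ne_zero hS)).resolve_left hS
  rcases i with n | n | n | n
  · obtain ⟨a1, a2, a3⟩ := hw n hi
    exact kill_LI q hq1 _ s _ (hd n).1 a2 a3 (fin (by simp [bk, key (.L (n + s)) a1]))
  · obtain ⟨a1, a2, a3⟩ := hw n hi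
    exact kill_LI q hq1 _ s _ (hd n).2.1 a2 a3 (fin (by simp [bk, key (.I (n + s)) a1]))
  · obtain ⟨a1, a2, a3⟩ := hw (n + 1) hi
    rw [show n + 1 + s = n + s + 1 by ring] at a1 a2 a3
    exact kill_GT q hq1 _ s _ (hd n).2.2.1 a2 a3 (fin (by simp [bk, key (.G (n + s)) a1]))
  · obtain ⟨a1, a2, a3⟩ := hw (n + 1) hi
    rw [show n + 1 + s = n + s + 1 by ring] at a1 a2 a3
    exact kill_GT q hq1 _ s _ (hd n).2.2.2 a2 a3 (fin (by simp [bk, key (.T (n + s)) a1]))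

theorem DerB_sub (q : ℂ) (s : ℤ) (φ χ : BIdx → Aq) (h1 : DerB q s φ) (h2 : DerB q s χ) :
    DerB q s (fun i => φ i - χ i) := by
  intro i j
  have e : ∀ x, Finsupp.linearCombination ℂ (fun i => φ i - χ i) x =
      Finsupp.linearCombination ℂ φ x - Finsupp.linearCombination ℂ χ x := by
    intro x
    simp [Finsupp.linearCombination_apply, smul_sub, Finsupp.sum]
  rw [e, h1 i j, h2 i j]
  simp only [map_sub, LinearMap.sub_apply]
  module

/-- for `s ≠ 0` with `q^s ≠ 1` and `q^s ≠ −1`, the space of even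
`q`-derivations of `𝔄_q` homogeneous of degree `s` equals the span of the inner
derivations `ad_{L_s}` and `ad_{I_s}`. -/
theorem even_q_derivations_are_inner
    (q : ℂ) (hq0 : q ≠ 0) (hq1 : q ≠ 1) (s : ℤ) (hs : s ≠ 0)
    (hqs1 : q ^ s ≠ 1) (hqs2 : q ^ s ≠ -1) :
    ∀ φ : BIdx → Aq, IsEvenQDerivation q s φ ↔
      ∃ a b : ℂ, ∀ i : BIdx, φ i = a • bk q (.L s) i + b • bk q (.I s) i := by
  intro φ
  rw [isEven_iff]
  constructor
  · rintro ⟨hd, hder⟩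
    obtain ⟨a, b, hab⟩ := Submodule.mem_span_pair.1 (hd 0).1
    have hsn := qnum_ne q hq1 hqs1
    refine ⟨a / qnum q s, b / qnum q s, fun i => ?_⟩
    refine sub_eq_zero.1 (vanish q hq0 hq1 s hqs1 hqs2
      (fun i => φ i - ((a / qnum q s) • bk q (.L s) i + (b / qnum q s) • bk q (.I s) i))
      ?_ (DerB_sub q s _ _ hder (inner_der q hq0 hq1 s hqs2 _ _)) ?_ i)
    · intro n
      obtain ⟨x1, x2, x3, x4⟩ := hd n
      obtain ⟨y1, y2, y3, y4⟩ := inner_deg q s (a / qnum q s) (b / qnum q s) n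
      exact ⟨Submodule.sub_mem _ x1 y1, Submodule.sub_mem _ x2 y2, Submodule.sub_mem _ x3 y3,
        Submodule.sub_mem _ x4 y4⟩
    · have h0 : qnum q 0 = 0 := by simp [qnum]
      simp only [← hab, bk, h0, sub_zero, Finsupp.smul_single, smul_eq_mul, zero_add, add_zero,
        div_mul_cancel₀ _ hsn, mul_one, sub_self]
  · rintro ⟨a, b, h⟩
    obtain rfl : φ = fun i => a • bk q (.L s) i + b • bk q (.I s) i := funext h
    exact ⟨inner_deg q s a b, inner_der q hq0 hq1 s hqs2 a b⟩
end

section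
/- Let (N, [·,…,·], α) be an n-ary multiplicative Hom-Nambu-Lie superalgebra. Then (𝓛(N), [·,·]_α, α̂) is a Hom-Leibniz superalgebra: for all homogeneous x, y, u ∈ 𝓛(N), [[x,y]_α, α̂(u)]_α = [α̂(x), [y,u]_α]_α − (−1)^{|x||y|} [α̂(y), [x,u]_α]_α. -/
/-- The total parity of a tuple of parities. -/
def tb {r : ℕ} (p : Fin r → Bool) : Bool := decide ((∑ k, pn (p k)) % 2 = 1)

/-- An `n`-ary multiplicative Hom-Nambu-Lie superalgebra, of arity `n = m + 2`:
a `ℤ₂`-graded vector space `N` with an even super skew-symmetric `n`-linear bracket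
`br` and an even multiplicative linear map `α` satisfying the super Hom-Nambu
identity. -/
structure NambuLieSuper (K N : Type*) [Field K] [AddCommGroup N] [Module K N]
    (m : ℕ) where
  deg : Bool → Submodule K N
  grading_sup : deg false ⊔ deg true = ⊤
  grading_inf : deg false ⊓ deg true = ⊥
  br : MultilinearMap K (fun _ : Fin (m + 2) => N) N
  α : N →ₗ[K] N
  α_even : ∀ b : Bool, ∀ v ∈ deg b, α v ∈ deg b
  br_even : ∀ (p : Fin (m + 2) → Bool) (x : Fin (m + 2) → N),
    (∀ k, x k ∈ deg (p k)) → br x ∈ deg (tb p)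
  br_skew : ∀ (p : Fin (m + 2) → Bool) (x : Fin (m + 2) → N),
    (∀ k, x k ∈ deg (p k)) → ∀ i j : Fin (m + 2), (i : ℕ) + 1 = (j : ℕ) →
      br (x ∘ Equiv.swap i j) = -(((-1 : K) ^ (pn (p i) * pn (p j))) • br x)
  mult : ∀ x : Fin (m + 2) → N, α (br x) = br (fun k => α (x k))
  nambu : ∀ (px : Fin (m + 1) → Bool) (x : Fin (m + 1) → N),
    (∀ k, x k ∈ deg (px k)) →
    ∀ (py : Fin (m + 2) → Bool) (y : Fin (m + 2) → N), (∀ k, y k ∈ deg (py k)) →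
    br (Fin.snoc (fun k => α (x k)) (br y)) =
      ∑ i : Fin (m + 2),
        ((-1 : K) ^ ((∑ k, pn (px k)) * ∑ k ∈ Finset.Iio i, pn (py k))) •
          br (fun k => if k = i then br (Fin.snoc x (y i)) else α (y k))

variable {K N : Type*} [Field K] [AddCommGroup N] [Module K N] {m : ℕ}

/-- The left multiplication `L(x)·z = [x₁,…,x_{n−1},z]`. -/
def Lx (S : NambuLieSuper K N m) (x : Fin (m + 1) → N) (z : N) : N :=
  S.br (Fin.snoc x z)

/-- The bracket `[x, y]_α` on the fundamental set `𝓛(N) = N^{⊗(n−1)}`, evaluated on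
decomposable tensors: `bx` is the total parity of `x` and `py` the parity vector of the
slots of `y`. -/
noncomputable def brT (S : NambuLieSuper K N m) (bx : Bool) (x : Fin (m + 1) → N)
    (py : Fin (m + 1) → Bool) (y : Fin (m + 1) → N) :
    PiTensorProduct K (fun _ : Fin (m + 1) => N) :=
  ∑ i : Fin (m + 1), ((-1 : K) ^ (pn bx * ∑ k ∈ Finset.Iio i, pn (py k))) •
    PiTensorProduct.tprod K (fun k => if k = i then Lx S x (y i) else S.α (y k))

theorem pn_tb_mod {r : ℕ} (p : Fin r → Bool) : pn (tb p) % 2 = (∑ k, pn (p k)) % 2 := by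
  unfold tb
  generalize (∑ k, pn (p k)) = s
  by_cases h : s % 2 = 1
  · simp [pn, h]
  · have : s % 2 = 0 := by omega
    simp [pn, this]

theorem pn_xor_mod (a b : Bool) : pn (xor a b) % 2 = (pn a + pn b) % 2 := by
  cases a <;> cases b <;> rfl

theorem sgn_congr {K : Type*} [Field K] {a b : ℕ} (h : a ≡ b [MOD 2]) :
    (-1 : K) ^ a = (-1 : K) ^ b := by
  rw [neg_one_pow_eq_pow_mod_two, h, ← neg_one_pow_eq_pow_mod_two]

theorem sum_Iio_mod {r : ℕ} (pu : Fin r → Bool) (c : Bool) (j l : Fin r) :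
    (∑ k ∈ Finset.Iio l, pn (if k = j then xor c (pu j) else pu k)) ≡
      (∑ k ∈ Finset.Iio l, pn (pu k)) + (if j < l then pn c else 0) [MOD 2] := by
  have h1 : (∑ k ∈ Finset.Iio l, pn (if k = j then xor c (pu j) else pu k)) ≡
      (∑ k ∈ Finset.Iio l, (pn (pu k) + if k = j then pn c else 0)) [MOD 2] := by
    unfold Nat.ModEq
    rw [Finset.sum_nat_mod, Finset.sum_nat_mod _ _ (fun k => pn (pu k) + if k = j then pn c else 0)]
    congr 1
    refine Finset.sum_congr rfl fun k _ => ?_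
    split_ifs with h
    · subst h; rw [pn_xor_mod, add_comm]
    · simp
  refine h1.trans ?_
  rw [Finset.sum_add_distrib, Finset.sum_ite_eq']
  simp [Nat.ModEq]

theorem key_identity (S : NambuLieSuper K N m)
    (px py : Fin (m + 1) → Bool) (x y : Fin (m + 1) → N)
    (hx : ∀ k, x k ∈ S.deg (px k)) (hy : ∀ k, y k ∈ S.deg (py k))
    (b : Bool) (z : N) (hz : z ∈ S.deg b) :
    ∑ i : Fin (m + 1), ((-1 : K) ^ ((∑ k, pn (px k)) * ∑ k ∈ Finset.Iio i, pn (py k))) •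
        Lx S (fun k => if k = i then Lx S x (y i) else S.α (y k)) (S.α z)
      = Lx S (fun k => S.α (x k)) (Lx S y z)
        - ((-1 : K) ^ ((∑ k, pn (px k)) * ∑ k, pn (py k))) •
          Lx S (fun k => S.α (y k)) (Lx S x z) := by
  have h := S.nambu px x hx (Fin.snoc (α := fun _ => Bool) py b)
    (Fin.snoc (α := fun _ => N) y z) (by
      intro k
      refine Fin.lastCases ?_ (fun k => ?_) k
      · simpa using hz
      · simpa using hy k)
  rw [Fin.sum_univ_castSucc] at h
  rw [eq_sub_iff_add_eq]
  unfold Lx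
  rw [h]
  congr 1
  · refine Finset.sum_congr rfl fun i _ => ?_
    congr 1
    · congr 2
      rw [← Fin.map_castSuccEmb_Iio, Finset.sum_map]
      simp
    · congr 1
      funext k
      refine Fin.lastCases ?_ (fun k => ?_) k
      · simp [(Fin.castSucc_lt_last i).ne']
      · simp
  · congr 1
    · congr 2
      rw [Fin.Iio_last_eq_map, Finset.sum_map]
      simp
    · congr 1
      funext k
      refine Fin.lastCases ?_ (fun k => ?_) k
      · simp
      · simp [(Fin.castSucc_lt_last k).ne]

/-- The linear map placing a vector in slot `l` with `α² u` elsewhere. -/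
noncomputable def slotMap (S : NambuLieSuper K N m) (u : Fin (m + 1) → N) (l : Fin (m + 1)) :
    N →ₗ[K] PiTensorProduct K (fun _ : Fin (m + 1) => N) :=
  (PiTensorProduct.tprod K).toLinearMap (fun k => S.α (S.α (u k))) l

theorem slotMap_apply (S : NambuLieSuper K N m) (u : Fin (m + 1) → N) (l : Fin (m + 1)) (v : N) :
    slotMap S u l v =
      PiTensorProduct.tprod K (fun k => if k = l then v else S.α (S.α (u k))) := by
  unfold slotMap
  rw [MultilinearMap.toLinearMap_apply]
  congr 1
  funext k
  simp [Function.update_apply]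

theorem α_Lx (S : NambuLieSuper K N m) (x : Fin (m + 1) → N) (z : N) :
    S.α (Lx S x z) = Lx S (fun k => S.α (x k)) (S.α z) := by
  unfold Lx
  rw [S.mult]
  congr 1
  funext k
  refine Fin.lastCases ?_ (fun k => ?_) k <;> simp

/-- Proposition 4.7: `(𝓛(N), [·,·]_α, α̂)` is a Hom-Leibniz superalgebra:
for homogeneous `x, y, u ∈ 𝓛(N)` (decomposable tensors with parity vectors
`px, py, pu`), `[[x,y]_α, α̂(u)]_α = [α̂(x), [y,u]_α]_α − (−1)^{|x||y|} [α̂(y), [x,u]_α]_α`,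
where the outer brackets are extended additively over the terms of the inner brackets. -/
theorem fundamental_set_is_HomLeibniz_superalgebra [CharZero K]
    (S : NambuLieSuper K N m)
    (px py pu : Fin (m + 1) → Bool) (x y u : Fin (m + 1) → N)
    (hx : ∀ k, x k ∈ S.deg (px k)) (hy : ∀ k, y k ∈ S.deg (py k))
    (hu : ∀ k, u k ∈ S.deg (pu k)) :
    ∑ i : Fin (m + 1),
        ((-1 : K) ^ ((∑ k, pn (px k)) * ∑ k ∈ Finset.Iio i, pn (py k))) •
          brT S (xor (tb px) (tb py)) (fun k => if k = i then Lx S x (y i) else S.α (y k))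
            pu (fun k => S.α (u k))
      = (∑ j : Fin (m + 1),
          ((-1 : K) ^ ((∑ k, pn (py k)) * ∑ k ∈ Finset.Iio j, pn (pu k))) •
            brT S (tb px) (fun k => S.α (x k))
              (fun k => if k = j then xor (tb py) (pu j) else pu k)
              (fun k => if k = j then Lx S y (u j) else S.α (u k)))
        - ((-1 : K) ^ ((∑ k, pn (px k)) * ∑ k, pn (py k))) •
            ∑ j : Fin (m + 1),
              ((-1 : K) ^ ((∑ k, pn (px k)) * ∑ k ∈ Finset.Iio j, pn (pu k))) •
                brT S (tb py) (fun k => S.α (y k))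
                  (fun k => if k = j then xor (tb px) (pu j) else pu k)
                  (fun k => if k = j then Lx S x (u j) else S.α (u k)) := by
  have hX := pn_tb_mod px
  have hY := pn_tb_mod py
  have hL : ∀ i : Fin (m + 1), brT S (xor (tb px) (tb py))
      (fun k => if k = i then Lx S x (y i) else S.α (y k)) pu (fun k => S.α (u k)) =
      ∑ l : Fin (m + 1), ((-1 : K) ^ (((∑ k, pn (px k)) + ∑ k, pn (py k)) *
        ∑ k ∈ Finset.Iio l, pn (pu k))) • slotMap S u l
          (Lx S (fun k => if k = i then Lx S x (y i) else S.α (y k)) (S.α (u l))) := by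
    intro i
    unfold brT
    refine Finset.sum_congr rfl fun l _ => ?_
    rw [slotMap_apply]
    congr 1
    apply sgn_congr
    refine Nat.ModEq.mul_right _ ((pn_xor_mod _ _).trans ?_)
    exact Nat.ModEq.add hX hY
  have hLHS : ∀ l : Fin (m + 1), ∑ i : Fin (m + 1),
      ((-1 : K) ^ ((∑ k, pn (px k)) * ∑ k ∈ Finset.Iio i, pn (py k))) •
      ((-1 : K) ^ (((∑ k, pn (px k)) + ∑ k, pn (py k)) *
        ∑ k ∈ Finset.Iio l, pn (pu k))) • slotMap S u l
          (Lx S (fun k => if k = i then Lx S x (y i) else S.α (y k)) (S.α (u l))) =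
      ((-1 : K) ^ (((∑ k, pn (px k)) + ∑ k, pn (py k)) *
        ∑ k ∈ Finset.Iio l, pn (pu k))) • slotMap S u l
          (Lx S (fun k => S.α (x k)) (Lx S y (u l))
            - ((-1 : K) ^ ((∑ k, pn (px k)) * ∑ k, pn (py k))) •
              Lx S (fun k => S.α (y k)) (Lx S x (u l))) := by
    intro l
    rw [← key_identity S px py x y hx hy (pu l) (u l) (hu l), map_sum, Finset.smul_sum]
    refine Finset.sum_congr rfl fun i _ => ?_
    rw [map_smul, smul_comm]
  simp only [hL, Finset.smul_sum]
  rw [Finset.sum_comm]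
  simp only [hLHS]
  unfold brT
  simp only [Finset.smul_sum]
  rw [Finset.sum_comm (s := Finset.univ) (t := Finset.univ)
    (f := fun j l => ((-1 : K) ^ ((∑ k, pn (px k)) * ∑ k, pn (py k))) • _),
    ← Finset.sum_sub_distrib]
  refine Finset.sum_congr rfl fun j _ => ?_
  rw [← Finset.sum_sub_distrib]
  refine Eq.trans ?_ (Finset.sum_eq_single j ?_ ?_).symm
  · have e : ∀ v w : N, (fun k => if k = j then v else S.α (if k = j then w else S.α (u k)))
        = (fun k => if k = j then v else S.α (S.α (u k))) := by
      intro v w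
      funext k
      split_ifs <;> rfl
    simp only [if_true, e, ← slotMap_apply]
    rw [map_sub, map_smul, smul_sub]
    simp only [smul_smul, ← pow_add]
    have g : ∀ c d : Bool, ∀ s : ℕ, (∑ k ∈ Finset.Iio j, pn (if k = j then d else pu k))
        = ∑ k ∈ Finset.Iio j, pn (pu k) := by
      intro c d s
      refine Finset.sum_congr rfl fun k hk => ?_
      rw [if_neg (Finset.mem_Iio.mp hk).ne]
    simp only [g true _ 0]
    generalize (∑ k ∈ Finset.Iio j, pn (pu k)) = U
    generalize (∑ k, pn (px k)) = X at *
    generalize (∑ k, pn (py k)) = Y at *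
    have hX' : pn (tb px) ≡ X [MOD 2] := hX
    have hY' : pn (tb py) ≡ Y [MOD 2] := hY
    congr 2
    · apply sgn_congr
      rw [add_mul, add_comm]
      exact Nat.ModEq.add_left _ (hX'.symm.mul_right _)
    · apply sgn_congr
      rw [add_comm, add_mul]
      exact Nat.ModEq.add_left _ (Nat.ModEq.add_left _ (hY'.symm.mul_right _))
  · intro l _ hlj
    have hjl : j ≠ l := fun h => hlj h.symm
    rw [sub_eq_zero]
    simp only [if_neg hlj, if_neg hjl]
    simp only [smul_smul, ← pow_add]
    congr 1
    · apply sgn_congr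
      have h1 := sum_Iio_mod pu (tb py) j l
      have h2 := sum_Iio_mod pu (tb px) l j
      generalize (∑ k ∈ Finset.Iio l, pn (if k = j then xor (tb py) (pu j) else pu k)) = P at *
      generalize (∑ k ∈ Finset.Iio j, pn (if k = l then xor (tb px) (pu l) else pu k)) = Q at *
      generalize (∑ k ∈ Finset.Iio j, pn (pu k)) = Uj at *
      generalize (∑ k ∈ Finset.Iio l, pn (pu k)) = Ul at *
      generalize (∑ k, pn (px k)) = X at *
      generalize (∑ k, pn (py k)) = Y at *
      have hX' : pn (tb px) ≡ X [MOD 2] := hX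
      have hY' : pn (tb py) ≡ Y [MOD 2] := hY
      have k1 := Nat.ModEq.add_left (Y * Uj) (hX'.mul h1)
      have k2 := Nat.ModEq.add_left (X * Y) (Nat.ModEq.add_left (X * Ul) (hY'.mul h2))
      refine k1.trans (Nat.ModEq.trans ?_ k2.symm)
      rcases lt_or_gt_of_ne hjl with h | h
      · rw [if_pos h, if_neg h.not_gt]
        have := Nat.ModEq.add_left (Y * Uj + X * Ul) (hY'.mul_left X)
        convert this using 1 <;> ring
      · rw [if_neg h.not_gt, if_pos h]
        have h3 := Nat.ModEq.add_left (X * Y + X * Ul + Y * Uj) (hX'.mul_left Y)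
        have h4 : X * Y + X * Ul + Y * Uj + Y * X ≡ Y * Uj + X * Ul [MOD 2] := by
          have : X * Y + X * Ul + Y * Uj + Y * X = Y * Uj + X * Ul + 2 * (X * Y) := by ring
          rw [this]
          simp [Nat.ModEq]
        refine Nat.ModEq.trans ?_ (Nat.ModEq.trans (h3.trans h4).symm ?_)
        · rw [add_zero]
        · rw [show ∀ a b : ℕ, (a ≡ b [MOD 2]) = (a % 2 = b % 2) from fun _ _ => rfl]; congr 1; ring
    · congr 1
      funext k
      by_cases h1 : k = l
      · subst h1
        simp [hlj, α_Lx]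
      · by_cases h2 : k = j
        · subst h2
          simp [h1, α_Lx]
        · simp [h1, h2]
  · simp
end
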